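/- Let L be an even unimodular lattice, let S be a primitive sublattice of L, and let T = S^⊥ be its orthogonal complement in L. Identify L with a subgroup of S* ⊕ T* inside L ⊗ ℚ, and let H denote the image of L/(S ⊕ T) in A_S ⊕ A_T. Then the restriction to H of the projection A_S ⊕ A_T → A_S is a bijection onto A_S, and the restriction to H of the projection A_S ⊕ A_T → A_T is a bijection onto A_T; consequently r_{S,T} := p_T ∘ (p_S|_H)^{-1} : A_S → A_T is a group isomorphism. -/

import Mathlib

noncomputable section

/-- The `ℤ`-submodule of `ℚ` consisting of the integers. -/
def intSub : Submodule ℤ ℚ := LinearMap.range (Algebra.linearMap ℤ ℚ)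

/-- The dual lattice `S* = {x ∈ span_ℚ S : ⟨x,s⟩ ∈ ℤ for all s ∈ S}` of a `ℤ`-submodule `S`
of a rational quadratic space, with respect to the bilinear form `B`. -/
def dualLat {V : Type*} [AddCommGroup V] [Module ℚ V]
    (B : V →ₗ[ℚ] V →ₗ[ℚ] ℚ) (S : Submodule ℤ V) : Submodule ℤ V :=
  (Submodule.span ℚ (S : Set V)).restrictScalars ℤ ⊓
    ⨅ s ∈ S, Submodule.comap ((B.flip s).restrictScalars ℤ) intSub

/-- The discriminant group `A_S = S*/S` of `S`. -/
abbrev discGrp {V : Type*} [AddCommGroup V] [Module ℚ V]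
    (B : V →ₗ[ℚ] V →ₗ[ℚ] ℚ) (S : Submodule ℤ V) :=
  ↥(dualLat B S) ⧸ Submodule.comap (dualLat B S).subtype S

/-- The image `H` of `L/(S ⊕ T)` in `A_S ⊕ A_T`, under the identification of `L` with a
subgroup of `S* ⊕ T*`: the set of pairs of classes `([x_S], [x_T])` with `x_S ∈ S*`,
`x_T ∈ T*` and `x_S + x_T ∈ L`. -/
def Hset {V : Type*} [AddCommGroup V] [Module ℚ V]
    (B : V →ₗ[ℚ] V →ₗ[ℚ] ℚ) (L S T : Submodule ℤ V) :
    Set (discGrp B S × discGrp B T) :=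
  {p | ∃ (xS : dualLat B S) (xT : dualLat B T),
    (xS : V) + (xT : V) ∈ L ∧
      p.1 = Submodule.Quotient.mk xS ∧ p.2 = Submodule.Quotient.mk xT}

theorem mem_dualLat_iff {V : Type*} [AddCommGroup V] [Module ℚ V]
    (B : V →ₗ[ℚ] V →ₗ[ℚ] ℚ) (S : Submodule ℤ V) (x : V) :
    x ∈ dualLat B S ↔ x ∈ Submodule.span ℚ (S : Set V) ∧
      ∀ s ∈ S, ∃ n : ℤ, B x s = (n : ℚ) := by
  simp only [dualLat, intSub, Submodule.mem_inf, Submodule.restrictScalars_mem,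
    Submodule.mem_iInf, Submodule.mem_comap, LinearMap.mem_range, Algebra.linearMap_apply]
  refine and_congr Iff.rfl (forall_congr' fun s => forall_congr' fun _ => ?_)
  exact exists_congr fun n => ⟨fun h => h.symm, fun h => h.symm⟩

theorem exists_int_smul_mem_aux {V : Type*} [AddCommGroup V] [Module ℚ V]
    (S : Submodule ℤ V) (x : V) (hx : x ∈ Submodule.span ℚ (S : Set V)) :
    ∃ c : ℤ, c ≠ 0 ∧ c • x ∈ S := by
  induction hx using Submodule.span_induction with
  | mem x h => exact ⟨1, one_ne_zero, by simpa using h⟩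
  | zero => exact ⟨1, one_ne_zero, by simp⟩
  | add x y _ _ hx hy =>
    obtain ⟨c, hc, hcx⟩ := hx
    obtain ⟨d, hd, hdy⟩ := hy
    refine ⟨c * d, mul_ne_zero hc hd, ?_⟩
    rw [smul_add]
    refine S.add_mem ?_ ?_
    · rw [mul_comm, mul_smul]; exact S.smul_mem _ hcx
    · rw [mul_smul]; exact S.smul_mem _ hdy
  | smul a x _ hx =>
    obtain ⟨c, hc, hcx⟩ := hx
    refine ⟨c * a.den, mul_ne_zero hc (by exact_mod_cast a.den_nz), ?_⟩
    have : (c * (a.den : ℤ)) • a • x = a.num • c • x := by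
      simp only [← Int.cast_smul_eq_zsmul ℚ, smul_smul]
      congr 1
      push_cast
      rw [mul_assoc, Rat.den_mul_eq_num, mul_comm]
    rw [this]
    exact S.smul_mem _ hcx

theorem mem_span_of_int_smul_aux {V : Type*} [AddCommGroup V] [Module ℚ V]
    (S : Submodule ℤ V) (x : V) (c : ℤ) (hc : c ≠ 0) (h : c • x ∈ S) :
    x ∈ Submodule.span ℚ (S : Set V) := by
  have h1 : (c : ℚ) • x ∈ Submodule.span ℚ (S : Set V) := by
    rw [Int.cast_smul_eq_zsmul]; exact Submodule.subset_span h
  exact (Submodule.smul_mem_iff _ (by exact_mod_cast hc)).1 h1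

theorem orth_span_aux {V : Type*} [AddCommGroup V] [Module ℚ V]
    (B : V →ₗ[ℚ] V →ₗ[ℚ] ℚ) (S : Submodule ℤ V) (x : V) (h : ∀ s ∈ S, B x s = 0)
    (y : V) (hy : y ∈ Submodule.span ℚ (S : Set V)) : B x y = 0 := by
  have : Submodule.span ℚ (S : Set V) ≤ LinearMap.ker (B x) :=
    Submodule.span_le.2 fun s hs => h s hs
  exact this hy

/-- A `ℤ`-linear map from a full lattice extends to the rational space. -/
theorem extend_aux {V : Type*} [AddCommGroup V] [Module ℚ V]
    (L : Submodule ℤ V) (hLfull : Submodule.span ℚ (L : Set V) = ⊤) (hLfg : L.FG)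
    (g : L →ₗ[ℤ] ℚ) : ∃ f : V →ₗ[ℚ] ℚ, ∀ x : L, f x = g x := by
  have : Module.Finite ℤ L := Module.Finite.iff_fg.2 hLfg
  have : IsAddTorsionFree V := IsAddTorsionFree.of_module_rat V
  have : Module.Free ℤ L := inferInstance
  let b := Module.Free.chooseBasis ℤ L
  have hli : LinearIndependent ℤ (fun i => (b i : V)) :=
    b.linearIndependent.map' L.subtype (by simp)
  have hliQ : LinearIndependent ℚ (fun i => (b i : V)) :=
    (LinearIndependent.iff_fractionRing ℤ ℚ).1 hli
  have hspan : ⊤ ≤ Submodule.span ℚ (Set.range fun i => (b i : V)) := by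
    rw [← hLfull, Submodule.span_le]
    intro x hx
    have := b.sum_repr ⟨x, hx⟩
    have h2 := congrArg (L.subtype) this
    simp only [map_sum, map_smul, Submodule.subtype_apply] at h2
    rw [← h2]
    refine Submodule.sum_mem _ fun i _ => ?_
    rw [← Int.cast_smul_eq_zsmul ℚ]
    exact Submodule.smul_mem _ _ (Submodule.subset_span ⟨i, rfl⟩)
  let bQ := Module.Basis.mk hliQ hspan
  refine ⟨bQ.constr ℚ (fun i => g (b i)), ?_⟩
  have : ((bQ.constr ℚ (fun i => g (b i))).restrictScalars ℤ).comp L.subtype = g := by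
    refine b.ext fun i => ?_
    have h3 : (b i : V) = bQ i := by simp [bQ]
    simp only [LinearMap.comp_apply, Submodule.subtype_apply, LinearMap.restrictScalars_apply]
    rw [h3, Module.Basis.constr_basis]
  exact fun x => LinearMap.congr_fun this x

/-- Primitive submodules admit a retraction. -/
theorem retract_aux {V : Type*} [AddCommGroup V] [Module ℚ V]
    (L : Submodule ℤ V) (hLfg : L.FG) (S : Submodule ℤ V)
    (hSprim : ∀ x ∈ L, ∀ c : ℤ, c ≠ 0 → c • x ∈ S → x ∈ S) :
    ∃ ρ : L →ₗ[ℤ] V, (∀ x, ρ x ∈ S) ∧ ∀ x : L, (x : V) ∈ S → ρ x = x := by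
  have : Module.Finite ℤ L := Module.Finite.iff_fg.2 hLfg
  let S' : Submodule ℤ L := S.comap L.subtype
  have : Module.IsTorsionFree ℤ (L ⧸ S') := by
    rw [Module.isTorsionFree_iff_smul_eq_zero]
    intro c q h
    by_cases hc : c = 0
    · exact Or.inl hc
    right
    obtain ⟨x, rfl⟩ := Submodule.Quotient.mk_surjective _ q
    rw [← Submodule.Quotient.mk_smul, Submodule.Quotient.mk_eq_zero] at h
    rw [Submodule.Quotient.mk_eq_zero]
    exact hSprim x x.2 c hc h
  have : Module.Free ℤ (L ⧸ S') := inferInstance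
  obtain ⟨σ, hσ⟩ := Module.projective_lifting_property S'.mkQ LinearMap.id
    (Submodule.mkQ_surjective S')
  refine ⟨L.subtype.comp (LinearMap.id - σ.comp S'.mkQ), fun x => ?_, fun x hx => ?_⟩
  · have : (LinearMap.id - σ.comp S'.mkQ : L →ₗ[ℤ] L) x ∈ S' := by
      rw [← Submodule.Quotient.mk_eq_zero, ← Submodule.mkQ_apply]
      have := LinearMap.congr_fun hσ (S'.mkQ x)
      simp only [LinearMap.comp_apply, LinearMap.id_apply] at this
      rw [LinearMap.sub_apply, map_sub, LinearMap.comp_apply, this, LinearMap.id_apply, sub_self]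
    exact this
  · have h0 : S'.mkQ x = 0 := (Submodule.Quotient.mk_eq_zero S').2 hx
    simp only [LinearMap.comp_apply, LinearMap.sub_apply, h0]
    simp

theorem surj_aux {V : Type*} [AddCommGroup V] [Module ℚ V] [FiniteDimensional ℚ V]
    (B : V →ₗ[ℚ] V →ₗ[ℚ] ℚ)
    (hnd : ∀ x : V, (∀ y : V, B x y = 0) → x = 0)
    (L : Submodule ℤ V) (hLfull : Submodule.span ℚ (L : Set V) = ⊤) (hLfg : L.FG)
    (hLint : ∀ x ∈ L, ∀ y ∈ L, ∃ n : ℤ, B x y = (n : ℚ))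
    (hLuni : dualLat B L = L)
    (S T : Submodule ℤ V) (hSL : S ≤ L) (hTL : T ≤ L)
    (hSprim : ∀ x ∈ L, ∀ c : ℤ, c ≠ 0 → c • x ∈ S → x ∈ S)
    (horth : ∀ s ∈ S, ∀ t ∈ T, B s t = 0)
    (hperp : ∀ x, (∀ s ∈ S, B x s = 0) → x ∈ Submodule.span ℚ (T : Set V))
    (hsym : ∀ x y, B x y = B y x)
    (x : V) (hx : x ∈ dualLat B S) : ∃ y ∈ dualLat B T, x + y ∈ L := by
  obtain ⟨ρ, hρS, hρ⟩ := retract_aux L hLfg S hSprim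
  obtain ⟨f, hf⟩ := extend_aux L hLfull hLfg (((B x).restrictScalars ℤ).comp ρ)
  have hinj : Function.Injective B := by
    rw [← LinearMap.ker_eq_bot, LinearMap.ker_eq_bot']
    intro m hm
    exact hnd m fun y => by rw [hm]; rfl
  have hsurj : Function.Surjective B :=
    (LinearMap.injective_iff_surjective_of_finrank_eq_finrank
      (Subspace.dual_finrank_eq (K := ℚ) (V := V)).symm).1 hinj
  obtain ⟨z, rfl⟩ := hsurj f
  rw [mem_dualLat_iff] at hx
  have hz : z ∈ L := by
    rw [← hLuni, mem_dualLat_iff]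
    refine ⟨by rw [hLfull]; trivial, fun s hs => ?_⟩
    rw [hf ⟨s, hs⟩]
    exact hx.2 _ (hρS _)
  refine ⟨z - x, ?_, by simpa using hz⟩
  rw [mem_dualLat_iff]
  refine ⟨hperp _ fun s hs => ?_, fun t ht => ?_⟩
  · have h1 := hf ⟨s, hSL hs⟩
    simp only [LinearMap.comp_apply, LinearMap.restrictScalars_apply] at h1
    rw [hρ _ hs] at h1
    rw [map_sub, LinearMap.sub_apply, h1, sub_self]
  · have : B x t = 0 := by
      rw [hsym]
      exact orth_span_aux B S t (fun s hs => by rw [hsym]; exact horth s hs t ht) x hx.1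
    rw [map_sub, LinearMap.sub_apply, this, sub_zero]
    exact hLint z hz t (hTL ht)

theorem inj_aux {V : Type*} [AddCommGroup V] [Module ℚ V]
    (B : V →ₗ[ℚ] V →ₗ[ℚ] ℚ)
    (L S T : Submodule ℤ V) (hSL : S ≤ L)
    (hTprim : ∀ x ∈ L, ∀ c : ℤ, c ≠ 0 → c • x ∈ T → x ∈ T)
    (x y : V) (hx : x ∈ S) (hy : y ∈ dualLat B T) (hxy : x + y ∈ L) : y ∈ T := by
  have hyL : y ∈ L := by simpa using L.sub_mem hxy (hSL hx)
  obtain ⟨c, hc, h⟩ := exists_int_smul_mem_aux T y ((mem_dualLat_iff B T y).1 hy).1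
  exact hTprim y hyL c hc h

/-- Let `L` be an even unimodular lattice (realized as a full `ℤ`-lattice in a rational
quadratic space `(V, B)`), `S` a primitive sublattice of `L`, and `T = S^⊥` its orthogonal
complement in `L`.  Then `L ⊆ S* ⊕ T*`, the restriction to `H` (the image of `L/(S ⊕ T)` in
`A_S ⊕ A_T`) of the projection to `A_S` is bijective, the restriction to `H` of the
projection to `A_T` is bijective, and consequently `r_{S,T} = p_T ∘ (p_S|_H)⁻¹ : A_S → A_T`
is a group isomorphism. -/
theorem proj_H_bijective
    (V : Type*) [AddCommGroup V] [Module ℚ V] [FiniteDimensional ℚ V]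
    (B : V →ₗ[ℚ] V →ₗ[ℚ] ℚ)
    (hsym : ∀ x y, B x y = B y x)
    (hnd : ∀ x : V, (∀ y : V, B x y = 0) → x = 0)
    (L : Submodule ℤ V) (hLfull : Submodule.span ℚ (L : Set V) = ⊤) (hLfg : L.FG)
    (hLint : ∀ x ∈ L, ∀ y ∈ L, ∃ n : ℤ, B x y = (n : ℚ))
    (hLeven : ∀ x ∈ L, ∃ n : ℤ, B x x = 2 * (n : ℚ))
    (hLuni : dualLat B L = L)
    (S : Submodule ℤ V) (hSL : S ≤ L)
    (hSnd : ∀ x ∈ S, (∀ y ∈ S, B x y = 0) → x = 0)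
    (hSprim : ∀ x ∈ L, ∀ c : ℤ, c ≠ 0 → c • x ∈ S → x ∈ S)
    (T : Submodule ℤ V) (hT : ∀ x : V, x ∈ T ↔ x ∈ L ∧ ∀ s ∈ S, B x s = 0) :
    L ≤ dualLat B S ⊔ dualLat B T ∧
    Function.Bijective (fun h : Hset B L S T => h.1.1) ∧
    Function.Bijective (fun h : Hset B L S T => h.1.2) ∧
    ∃ r : discGrp B S ≃+ discGrp B T, ∀ p ∈ Hset B L S T, r p.1 = p.2 := by
  have hTL : T ≤ L := fun x hx => ((hT x).1 hx).1
  have horth : ∀ s ∈ S, ∀ t ∈ T, B s t = 0 := fun s hs t ht => by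
    rw [hsym]; exact ((hT t).1 ht).2 s hs
  have horth' : ∀ t ∈ T, ∀ s ∈ S, B t s = 0 := fun t ht s hs => ((hT t).1 ht).2 s hs
  have hTprim : ∀ x ∈ L, ∀ c : ℤ, c ≠ 0 → c • x ∈ T → x ∈ T := by
    intro x hx c hc h
    refine (hT x).2 ⟨hx, fun s hs => ?_⟩
    have h1 := horth' _ h s hs
    rw [← Int.cast_smul_eq_zsmul ℚ, map_smul, LinearMap.smul_apply, smul_eq_mul] at h1
    exact (mul_eq_zero.1 h1).resolve_left (by exact_mod_cast hc)
  have hperp : ∀ x, (∀ s ∈ S, B x s = 0) → x ∈ Submodule.span ℚ (T : Set V) := by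
    intro x hx
    obtain ⟨c, hc, h⟩ := exists_int_smul_mem_aux L x (by rw [hLfull]; trivial)
    refine mem_span_of_int_smul_aux T x c hc ((hT _).2 ⟨h, fun s hs => ?_⟩)
    rw [← Int.cast_smul_eq_zsmul ℚ, map_smul, LinearMap.smul_apply, hx s hs, smul_zero]
  have hWnd : ∀ x ∈ Submodule.span ℚ (S : Set V), (∀ s ∈ S, B x s = 0) → x = 0 := by
    intro x hx h
    obtain ⟨c, hc, hcx⟩ := exists_int_smul_mem_aux S x hx
    have h0 : c • x = 0 := hSnd _ hcx fun y hy => by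
      rw [← Int.cast_smul_eq_zsmul ℚ, map_smul, LinearMap.smul_apply, h y hy, smul_zero]
    rw [← Int.cast_smul_eq_zsmul ℚ] at h0
    exact (smul_eq_zero.1 h0).resolve_left (by exact_mod_cast hc)
  -- orthogonal decomposition
  have hdec : ∀ x : V, ∃ w ∈ Submodule.span ℚ (S : Set V), ∀ s ∈ S, B (x - w) s = 0 := by
    intro x
    let W := Submodule.span ℚ (S : Set V)
    let φ : W →ₗ[ℚ] Module.Dual ℚ W := (B.domRestrict₁₂ W W)
    have hinj : Function.Injective φ := by
      rw [← LinearMap.ker_eq_bot, LinearMap.ker_eq_bot']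
      intro m hm
      refine Subtype.ext (hWnd m m.2 fun s hs => ?_)
      exact LinearMap.congr_fun hm ⟨s, Submodule.subset_span hs⟩
    have hsurj : Function.Surjective φ :=
      (LinearMap.injective_iff_surjective_of_finrank_eq_finrank
        (Subspace.dual_finrank_eq (K := ℚ) (V := W)).symm).1 hinj
    obtain ⟨w, hw⟩ := hsurj ((B x).comp W.subtype)
    refine ⟨w, w.2, fun s hs => ?_⟩
    have h1 : B w s = B x s := LinearMap.congr_fun hw ⟨s, Submodule.subset_span hs⟩
    rw [map_sub, LinearMap.sub_apply, h1, sub_self]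
  have hperp' : ∀ x, (∀ t ∈ T, B x t = 0) → x ∈ Submodule.span ℚ (S : Set V) := by
    intro x hx
    obtain ⟨w, hw, h⟩ := hdec x
    have h0 : x - w = 0 := by
      refine hnd _ fun y => ?_
      obtain ⟨u, hu, h'⟩ := hdec y
      have h1 := orth_span_aux B S _ h u hu
      have h2 : B (x - w) (y - u) = 0 := by
        refine orth_span_aux B T (x - w) (fun t ht => ?_) _ (hperp _ h')
        rw [map_sub, LinearMap.sub_apply, hx t ht, hsym w t,
          orth_span_aux B S t (horth' t ht) w hw, sub_zero]
      rw [map_sub, h1, sub_zero] at h2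
      exact h2
    rw [sub_eq_zero.1 h0]; exact hw
  have hA := surj_aux B hnd L hLfull hLfg hLint hLuni S T hSL hTL hSprim horth hperp hsym
  have hB := surj_aux B hnd L hLfull hLfg hLint hLuni T S hTL hSL hTprim horth' hperp' hsym
  have hbS : Function.Bijective (fun h : Hset B L S T => h.1.1) := by
    constructor
    · rintro ⟨p, xS, xT, hx, hp1, hp2⟩ ⟨q, yS, yT, hy, hq1, hq2⟩ h
      dsimp only at h
      have h1 : (xS : V) - yS ∈ S :=
        (Submodule.Quotient.eq (Submodule.comap (dualLat B S).subtype S)).1 (hp1.symm.trans (h.trans hq1))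
      have h2 : (Submodule.Quotient.mk xT : discGrp B T) = Submodule.Quotient.mk yT := by
        refine (Submodule.Quotient.eq _).2 ?_
        refine inj_aux B L S T hSL hTprim _ ((xT : V) - yT) h1 ((dualLat B T).sub_mem xT.2 yT.2) ?_
        convert L.sub_mem hx hy using 1
        abel
      exact Subtype.ext (Prod.ext h (hp2.trans (h2.trans hq2.symm)))
    · intro q
      obtain ⟨x, rfl⟩ := Submodule.Quotient.mk_surjective _ q
      obtain ⟨y, hy, hxy⟩ := hA x x.2
      exact ⟨⟨(Submodule.Quotient.mk x, Submodule.Quotient.mk ⟨y, hy⟩),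
        x, ⟨y, hy⟩, hxy, rfl, rfl⟩, rfl⟩
  have hbT : Function.Bijective (fun h : Hset B L S T => h.1.2) := by
    constructor
    · rintro ⟨p, xS, xT, hx, hp1, hp2⟩ ⟨q, yS, yT, hy, hq1, hq2⟩ h
      dsimp only at h
      have h1 : (xT : V) - yT ∈ T :=
        (Submodule.Quotient.eq (Submodule.comap (dualLat B T).subtype T)).1 (hp2.symm.trans (h.trans hq2))
      have h2 : (Submodule.Quotient.mk xS : discGrp B S) = Submodule.Quotient.mk yS := by
        refine (Submodule.Quotient.eq _).2 ?_
        refine inj_aux B L T S hTL hSprim _ ((xS : V) - yS) h1 ((dualLat B S).sub_mem xS.2 yS.2) ?_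
        convert L.sub_mem hx hy using 1
        abel
      exact Subtype.ext (Prod.ext (hp1.trans (h2.trans hq1.symm)) h)
    · intro q
      obtain ⟨x, rfl⟩ := Submodule.Quotient.mk_surjective _ q
      obtain ⟨y, hy, hxy⟩ := hB x x.2
      exact ⟨⟨(Submodule.Quotient.mk ⟨y, hy⟩, Submodule.Quotient.mk x),
        ⟨y, hy⟩, x, by rw [add_comm]; exact hxy, rfl, rfl⟩, rfl⟩
  refine ⟨?_, hbS, hbT, ?_⟩
  · intro x hx
    obtain ⟨w, hw, h⟩ := hdec x
    refine Submodule.mem_sup.2 ⟨w, ?_, x - w, ?_, by abel⟩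
    · refine (mem_dualLat_iff _ _ _).2 ⟨hw, fun s hs => ?_⟩
      have h1 := h s hs
      rw [map_sub, LinearMap.sub_apply, sub_eq_zero] at h1
      rw [← h1]
      exact hLint x hx s (hSL hs)
    · refine (mem_dualLat_iff _ _ _).2 ⟨hperp _ h, fun t ht => ?_⟩
      rw [map_sub, LinearMap.sub_apply, hsym w t,
          orth_span_aux B S t (horth' t ht) w hw, sub_zero]
      exact hLint x hx t (hTL ht)
  · let e := (Equiv.ofBijective _ hbS).symm.trans (Equiv.ofBijective _ hbT)
    have he : ∀ p ∈ Hset B L S T, e p.1 = p.2 := by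
      intro p hp
      have h1 : (Equiv.ofBijective _ hbS).symm p.1 = ⟨p, hp⟩ :=
        (Equiv.symm_apply_eq _).2 rfl
      show (Equiv.ofBijective _ hbT) ((Equiv.ofBijective _ hbS).symm p.1) = p.2
      rw [h1]; rfl
    have hadd : ∀ a b, e (a + b) = e a + e b := by
      intro a b
      obtain ⟨⟨p, hp⟩, rfl⟩ := hbS.2 a
      obtain ⟨⟨q, hq⟩, rfl⟩ := hbS.2 b
      have hpq : p + q ∈ Hset B L S T := by
        obtain ⟨xS, xT, hx, h1, h2⟩ := hp
        obtain ⟨yS, yT, hy, h3, h4⟩ := hq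
        refine ⟨xS + yS, xT + yT, ?_, ?_, ?_⟩
        · convert L.add_mem hx hy using 1
          push_cast
          abel
        · rw [Prod.fst_add, h1, h3, Submodule.Quotient.mk_add]
        · rw [Prod.snd_add, h2, h4, Submodule.Quotient.mk_add]
      have := he _ hpq
      rw [Prod.fst_add, Prod.snd_add, ← he p hp, ← he q hq] at this
      exact this
    exact ⟨AddEquiv.mk' e hadd, he⟩
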